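/- Let n ≥ 1, r > 0, and let u be a twice continuously differentiable real-valued function defined on an open neighborhood of the closed ball B̄(0,r) = {x ∈ ℝⁿ : ‖x‖ ≤ r} satisfying Δu(x) ≥ 1 for all x with ‖x‖ ≤ r. Then for every point y with ‖y‖ < r one has sup_{‖x‖ = r} u(x) ≥ (r² − ‖y‖²)/(2n) + u(y). -/

import Mathlib

/-- The Laplacian `Δu(x) = ∑ i, ∂²u/∂x_i²(x)`. -/
noncomputable def laplacian {n : ℕ} (u : EuclideanSpace ℝ (Fin n) → ℝ)
    (x : EuclideanSpace ℝ (Fin n)) : ℝ :=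
  ∑ i : Fin n,
    fderiv ℝ (fun y => fderiv ℝ u y (EuclideanSpace.single i 1)) x (EuclideanSpace.single i 1)

open Filter Topology in
/-- The second derivative is nonpositive at a local maximum. -/
theorem IsLocalMax.deriv_deriv_nonpos {f : ℝ → ℝ} {a : ℝ} (h : IsLocalMax f a)
    (hf : ContinuousAt f a) : deriv (deriv f) a ≤ 0 := by
  by_contra! hpos
  have hmin : IsLocalMin f a := isLocalMin_of_deriv_deriv_pos hpos h.deriv_eq_zero hf
  have hconst : f =ᶠ[𝓝 a] fun _ => f a := by
    filter_upwards [h, hmin] with x h₁ h₂ using le_antisymm h₁ h₂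
  rw [hconst.deriv.deriv_eq] at hpos
  simp at hpos

open Filter Topology in
/-- If `x ↦ u x - c ‖x‖²` has a local maximum at `x`, then every pure second derivative of `u`
along a unit vector is at most `2 c` at `x`. -/
theorem fderiv_fderiv_le_of_isLocalMax_sub_norm_sq {E : Type*} [NormedAddCommGroup E]
    [InnerProductSpace ℝ E] {u : E → ℝ} {c : ℝ} {x e : E} (he : ‖e‖ = 1)
    (hu : ContDiffAt ℝ 2 u x) (h : IsLocalMax (fun z => u z - c * ‖z‖ ^ 2) x) :
    fderiv ℝ (fun z => fderiv ℝ u z e) x e ≤ 2 * c := by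
  have hline (t : ℝ) : HasDerivAt (fun s : ℝ => x + s • e) e t := by
    simpa using ((hasDerivAt_id t).smul_const e).const_add x
  have hline₀ : Tendsto (fun s : ℝ => x + s • e) (𝓝 0) (𝓝 x) := by
    simpa using (hline 0).continuousAt.tendsto
  have hquad (t : ℝ) : HasDerivAt (fun s : ℝ => c * ‖x + s • e‖ ^ 2)
      (c * (2 * inner ℝ x e + 2 * t)) t := by
    have hexp : (fun s : ℝ => c * ‖x + s • e‖ ^ 2) =
        fun s => c * (‖x‖ ^ 2 + 2 * inner ℝ x e * s + s ^ 2) := by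
      funext s
      rw [norm_add_sq_real, inner_smul_right, norm_smul, he, mul_one, Real.norm_eq_abs, sq_abs]
      ring
    rw [hexp]
    refine HasDerivAt.const_mul c ?_
    have hsum := (((hasDerivAt_id t).const_mul (2 * inner ℝ x e)).const_add (‖x‖ ^ 2)).add
      (hasDerivAt_pow 2 t)
    exact hsum.congr_deriv (by simp)
  set g : ℝ → ℝ := fun s => u (x + s • e) - c * ‖x + s • e‖ ^ 2 with hg
  have hdiff : ∀ᶠ t in 𝓝 (0 : ℝ), HasDerivAt g
      (fderiv ℝ u (x + t • e) e - c * (2 * inner ℝ x e + 2 * t)) t := by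
    filter_upwards [hline₀.eventually (hu.eventually (by simp))] with t ht
    exact ((ht.differentiableAt (by simp)).hasFDerivAt.comp_hasDerivAt t (hline t)).sub (hquad t)
  have hmax : IsLocalMax g 0 := by
    have := hline₀.eventually h
    filter_upwards [this] with t ht
    simpa [hg] using ht
  have hd : DifferentiableAt ℝ (fun z => fderiv ℝ u z e) x :=
    ((hu.fderiv_right (m := 1) (by norm_num)).differentiableAt (by simp)).clm_apply
      (differentiableAt_const e)
  have hd' : HasDerivAt (fun t : ℝ => fderiv ℝ u (x + t • e) e)
      (fderiv ℝ (fun z => fderiv ℝ u z e) x e) 0 := by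
    refine HasFDerivAt.comp_hasDerivAt (l := fun z => fderiv ℝ u z e) 0 ?_ (hline 0)
    simpa using hd.hasFDerivAt
  have hlin : HasDerivAt (fun t : ℝ => c * (2 * inner ℝ x e + 2 * t)) (c * 2) 0 := by
    simpa using
      (((hasDerivAt_id (0 : ℝ)).const_mul 2).const_add (2 * inner ℝ x e)).const_mul c
  have hderiv : deriv g =ᶠ[𝓝 0]
      fun t => fderiv ℝ u (x + t • e) e - c * (2 * inner ℝ x e + 2 * t) :=
    hdiff.mono fun t ht => ht.deriv
  have hle := hmax.deriv_deriv_nonpos hdiff.self_of_nhds.continuousAt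
  rw [hderiv.deriv_eq, deriv_fun_sub hd'.differentiableAt hlin.differentiableAt, hd'.deriv,
    hlin.deriv] at hle
  linarith

/-- If `Δu ≥ 1` on the closed ball of radius `r`, then for every interior point `y`,
`sup_{‖x‖ = r} u(x) ≥ (r² − ‖y‖²)/(2n) + u(y)`. -/
theorem sup_on_sphere_of_laplacian_ge_one (n : ℕ) (hn : 1 ≤ n) (r : ℝ) (hr : 0 < r)
    (U : Set (EuclideanSpace ℝ (Fin n))) (hU : IsOpen U)
    (hBU : Metric.closedBall (0 : EuclideanSpace ℝ (Fin n)) r ⊆ U)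
    (u : EuclideanSpace ℝ (Fin n) → ℝ) (hu : ContDiffOn ℝ 2 u U)
    (hlap : ∀ x ∈ Metric.closedBall (0 : EuclideanSpace ℝ (Fin n)) r, 1 ≤ laplacian u x)
    (y : EuclideanSpace ℝ (Fin n)) (hy : ‖y‖ < r) :
    (r ^ 2 - ‖y‖ ^ 2) / (2 * n) + u y ≤
      sSup (u '' Metric.sphere (0 : EuclideanSpace ℝ (Fin n)) r) := by
  have hn' : (0 : ℝ) < n := by exact_mod_cast hn
  have hcont : ContinuousOn u (Metric.closedBall 0 r) := hu.continuousOn.mono hBU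
  have hbdd : BddAbove (u '' Metric.sphere 0 r) :=
    (isCompact_sphere _ _).bddAbove_image (hcont.mono Metric.sphere_subset_closedBall)
  have hpos : 0 < r ^ 2 - ‖y‖ ^ 2 := by nlinarith [norm_nonneg y]
  have key (c : ℝ) (hc : c < 1 / (2 * n)) :
      c * (r ^ 2 - ‖y‖ ^ 2) + u y ≤ sSup (u '' Metric.sphere 0 r) := by
    obtain ⟨x, hx, hmax⟩ := (isCompact_closedBall (0 : EuclideanSpace ℝ (Fin n)) r).exists_isMaxOn
      ⟨0, by simp [hr.le]⟩ (hcont.sub (by fun_prop : ContinuousOn (fun z => c * ‖z‖ ^ 2) _))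
    have hxr : ‖x‖ = r := by
      refine le_antisymm (by simpa using hx) ?_
      by_contra! hlt
      have hloc : IsLocalMax (fun z => u z - c * ‖z‖ ^ 2) x :=
        hmax.isLocalMax (Metric.closedBall_mem_nhds_of_mem (by simpa using hlt))
      have hle : laplacian u x ≤ ∑ _i : Fin n, 2 * c := Finset.sum_le_sum fun i _ =>
        fderiv_fderiv_le_of_isLocalMax_sub_norm_sq (by simp)
          (hu.contDiffAt (hU.mem_nhds (hBU hx))) hloc
      rw [Finset.sum_const, Finset.card_univ, Fintype.card_fin, nsmul_eq_mul] at hle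
      rw [lt_div_iff₀ (by positivity)] at hc
      linarith [hlap x hx]
    have hyx : u y - c * ‖y‖ ^ 2 ≤ u x - c * ‖x‖ ^ 2 := hmax (by simpa using hy.le)
    have hxs : u x ≤ sSup (u '' Metric.sphere 0 r) :=
      le_csSup hbdd ⟨x, by simpa using hxr, rfl⟩
    rw [hxr] at hyx
    linarith
  have hle : 1 / (2 * (n : ℝ)) ≤
      (sSup (u '' Metric.sphere 0 r) - u y) / (r ^ 2 - ‖y‖ ^ 2) :=
    le_of_forall_lt fun c hc => by
      obtain ⟨d, hcd, hd⟩ := exists_between hc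
      refine hcd.trans_le ?_
      rw [le_div_iff₀ hpos]
      linarith [key d hd]
  rw [le_div_iff₀ hpos, one_div_mul_eq_div] at hle
  linarith
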